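/- Conservativeness of the centralized ESCI bound. Let ω lie in the unit simplex of R^N with ω_i > 0 for all i, let P_1^{(1)}, …, P_N^{(1)} be d × d positive semidefinite matrices, and let P^{(2)} be a positive semidefinite Nd × Nd matrix. Then for every positive semidefinite Nd × Nd matrix P^{(1)} whose i-th diagonal d × d block equals P_i^{(1)} for every i, one has P^{(1)} + P^{(2)} ⪯ diag(ω_1^{-1} P_1^{(1)}, …, ω_N^{-1} P_N^{(1)}) + P^{(2)}; that is, B_cent is a conservative bound on every admissible centralized covariance in A_ESCI. -/

import Mathlib

open Matrix

/-- The covariance of the values `ω⁻¹ 1_{a}` and `ω⁻¹ 1_{b}` under the probability weights `ω`. -/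
theorem sum_weight_mul_centered_indicator {ι : Type*} [Fintype ι] [DecidableEq ι]
    {ω : ι → ℝ} (hω : ∀ i, ω i ≠ 0) (hsum : ∑ i, ω i = 1) (a b : ι) :
    ∑ i, ω i * (((if a = i then (ω i)⁻¹ else 0) - 1) * ((if b = i then (ω i)⁻¹ else 0) - 1)) =
      (if a = b then (ω a)⁻¹ else 0) - 1 := by
  have h (i : ι) :
      ω i * (((if a = i then (ω i)⁻¹ else 0) - 1) * ((if b = i then (ω i)⁻¹ else 0) - 1)) =
        (if a = i then (if b = i then (ω i)⁻¹ else 0) else 0) - (if a = i then 1 else 0)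
          - (if b = i then 1 else 0) + ω i := by
    have := hω i
    split_ifs <;> field_simp <;> ring
  simp only [h]
  simp only [Finset.sum_add_distrib, Finset.sum_sub_distrib, Finset.sum_ite_eq,
    Finset.mem_univ, if_true, hsum, eq_comm (a := b) (b := a)]
  ring

/-- The block diagonal of a positive semidefinite matrix, with its blocks inflated by inverse
convex weights, dominates the matrix. -/
theorem Matrix.PosSemidef.blockDiagonal_inv_smul_sub {m ι : Type*} [Fintype m] [DecidableEq m]
    [Fintype ι] [DecidableEq ι] {A : Matrix (m × ι) (m × ι) ℝ} (hA : A.PosSemidef)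
    {ω : ι → ℝ} (hω : ∀ i, 0 < ω i) (hsum : ∑ i, ω i = 1) :
    (blockDiagonal (fun i => (ω i)⁻¹ • blockDiag A i) - A).PosSemidef := by
  let D (i : ι) : Matrix (m × ι) (m × ι) ℝ :=
    diagonal fun p => (if p.2 = i then (ω i)⁻¹ else 0) - 1
  have key : blockDiagonal (fun i => (ω i)⁻¹ • blockDiag A i) - A =
      ∑ i, ω i • (D i * A * (D i)ᴴ) := by
    ext ⟨k, a⟩ ⟨l, b⟩
    have h := congrArg (· * A (k, a) (l, b))
      (sum_weight_mul_centered_indicator (fun i => (hω i).ne') hsum a b)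
    simp only [Finset.sum_mul] at h
    simp only [D, Matrix.sum_apply, Matrix.smul_apply, diagonal_conjTranspose, mul_diagonal,
      diagonal_mul, Matrix.sub_apply, blockDiagonal_apply, blockDiag_apply, smul_eq_mul, star_trivial]
    trans ((if a = b then (ω a)⁻¹ else 0) - 1) * A (k, a) (l, b)
    · split_ifs with hab
      · subst hab; ring
      · ring
    · rw [← h]
      exact Finset.sum_congr rfl fun i _ => by ring
  rw [key]
  exact posSemidef_sum _ fun i _ => (hA.mul_mul_conjTranspose_same (D i)).smul (hω i).le

/-- Conservativeness of the centralized ESCI bound: `B_cent` dominates every admissible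
centralized covariance `P⁽¹⁾ + P⁽²⁾` in the set `A_ESCI`. -/
theorem ESCI_centralized_bound {d N : ℕ} (hd : 1 ≤ d) (hN : 1 ≤ N)
    (ω : Fin N → ℝ) (hω : ∀ i, 0 < ω i) (hsum : ∑ i, ω i = 1)
    (P1 : Fin N → Matrix (Fin d) (Fin d) ℝ) (hP1 : ∀ i, (P1 i).PosSemidef)
    (P2 : Matrix (Fin d × Fin N) (Fin d × Fin N) ℝ) (hP2 : P2.PosSemidef) :
    ∀ P1c : Matrix (Fin d × Fin N) (Fin d × Fin N) ℝ,
      P1c.PosSemidef → (∀ i k l, P1c (k, i) (l, i) = P1 i k l) →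
      (Matrix.blockDiagonal (fun i => (ω i)⁻¹ • P1 i) + P2 - (P1c + P2)).PosSemidef := by
  intro P1c hP1c hblock
  obtain rfl : blockDiag P1c = P1 := by
    ext i k l
    exact hblock i k l
  rw [add_sub_add_right_eq_sub]
  exact hP1c.blockDiagonal_inv_smul_sub hω hsum
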